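/- arXiv:math/0411407 — 2 statements merged into one kernel-verified Lean document; each statement's English description precedes it below -/
import Mathlib

section
/- For N >= 1, the generating function of the number a_n of compositions of n with no part divisible by N satisfies sum_{n>=0} a_n t^n = (1 - t^N)/(1 - t - t^2 - ... - t^N), as an identity of formal power series. -/
open PowerSeries

/-- `a N n` is the number of compositions of `n` with no part divisible by `N`. -/
def aComp (N n : ℕ) : ℕ :=
  ((Finset.univ : Finset (Composition n)).filter
    (fun c => ∀ p ∈ c.blocks, ¬ N ∣ p)).card

/-- Splitting off the first part `i` of a nonempty composition. -/
theorem aComp_eq_sum_antidiagonal (N : ℕ) {n : ℕ} (hn : n ≠ 0) :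
    aComp N n = ∑ x ∈ Finset.HasAntidiagonal.antidiagonal n, (if N ∣ x.1 then 0 else 1) * aComp N x.2 := by
  have hsum : ∑ x ∈ Finset.HasAntidiagonal.antidiagonal n, (if N ∣ x.1 then 0 else 1) * aComp N x.2 =
      (((Finset.HasAntidiagonal.antidiagonal n).filter (fun x => ¬ N ∣ x.1)).sigma (fun x =>
        (Finset.univ : Finset (Composition x.2)).filter
          (fun c => ∀ p ∈ c.blocks, ¬ N ∣ p))).card := by
    rw [Finset.card_sigma, Finset.sum_filter]
    refine Finset.sum_congr rfl fun x _ => ?_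
    by_cases h : N ∣ x.1 <;> simp [h, aComp]
  rw [hsum, aComp]
  symm
  refine Finset.card_bij (fun y hy => ⟨y.1.1 :: y.2.blocks, ?_, ?_⟩) ?_ ?_ ?_
  · intro i hi
    simp only [Finset.mem_sigma, Finset.mem_filter] at hy
    rcases List.mem_cons.1 hi with rfl | hi
    · exact Nat.pos_of_ne_zero fun h => hy.1.2 (h ▸ dvd_zero N)
    · exact y.2.blocks_pos hi
  · simp only [Finset.mem_sigma, Finset.mem_filter, Finset.HasAntidiagonal.mem_antidiagonal] at hy
    simpa using hy.1.1
  · intro y hy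
    simp only [Finset.mem_sigma, Finset.mem_filter, Finset.mem_univ, true_and] at hy
    simpa using ⟨hy.1.2, hy.2⟩
  · rintro ⟨⟨i, j⟩, c⟩ _ ⟨⟨i', j'⟩, c'⟩ _ h
    obtain ⟨hi, hc⟩ : i = i' ∧ c.blocks = c'.blocks := by simpa using h
    obtain rfl : j = j' := c.blocks_sum.symm.trans (hc ▸ c'.blocks_sum)
    obtain rfl : c = c' := Composition.ext hc
    rw [hi]
  · rintro ⟨l, hpos, hl⟩ hc
    cases l with
    | nil => exact absurd hl.symm hn
    | cons i l =>
      simp only [Finset.mem_filter, Finset.mem_univ, true_and, List.forall_mem_cons] at hc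
      refine ⟨⟨(i, l.sum), ⟨l, fun h => hpos (List.mem_cons_of_mem i h), rfl⟩⟩, ?_, rfl⟩
      simpa [hc.1] using ⟨by simpa using hl, hc.2⟩

theorem aComp_zero (N : ℕ) : aComp N 0 = 1 := by
  rw [aComp, Finset.filter_true_of_mem]
  · simp [composition_card]
  · intro c _ p hp
    simp [c.blocks_eq_nil.2 rfl] at hp

/-- The first-part decomposition of compositions, as an identity of generating functions. -/
theorem mk_aComp_eq_one_add (N : ℕ) :
    PowerSeries.mk (fun n => (aComp N n : ℚ)) =
      1 + PowerSeries.mk (fun k => if N ∣ k then (0 : ℚ) else 1) *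
        PowerSeries.mk (fun n => (aComp N n : ℚ)) := by
  ext n
  rw [map_add, coeff_mul, coeff_one]
  simp only [coeff_mk]
  by_cases hn : n = 0
  · subst hn
    simp [aComp_zero]
  · rw [if_neg hn, zero_add, aComp_eq_sum_antidiagonal N hn]
    push_cast
    rfl

theorem mk_not_dvd_mul_one_sub_X_pow {N : ℕ} (hN : 1 ≤ N) :
    PowerSeries.mk (fun k => if N ∣ k then (0 : ℚ) else 1) * (1 - X ^ N) =
      ∑ k ∈ Finset.Icc 1 N, (X : PowerSeries ℚ) ^ k - X ^ N := by
  ext n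
  rw [mul_sub, mul_one, map_sub, map_sub, coeff_mul_X_pow', map_sum]
  simp only [coeff_mk, coeff_X_pow, Finset.sum_ite_eq, Finset.mem_Icc]
  rcases lt_trichotomy n N with h | rfl | h
  · rcases Nat.eq_zero_or_pos n with rfl | hn
    · simp [show ¬ N ≤ 0 by omega, show 0 ≠ N by omega]
    · simp [Nat.not_dvd_of_pos_of_lt hn h, h.not_ge, h.le, h.ne, Nat.succ_le_of_lt hn]
  · simp [hN]
  · simp [h.le, h.not_ge, h.ne', Nat.dvd_sub_self_right]

/-- For `N ≥ 1`, `∑_{n≥0} a_n t^n = (1 - t^N)/(1 - t - t^2 - ⋯ - t^N)`. -/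
theorem aComp_generating_function (N : ℕ) (hN : 1 ≤ N) :
    PowerSeries.mk (fun n => (aComp N n : ℚ)) =
      (1 - (X : PowerSeries ℚ) ^ N) * (1 - ∑ k ∈ Finset.Icc 1 N, (X : PowerSeries ℚ) ^ k)⁻¹ := by
  rw [PowerSeries.eq_mul_inv_iff_mul_eq]
  · linear_combination (1 - (X : PowerSeries ℚ) ^ N) * mk_aComp_eq_one_add N +
      PowerSeries.mk (fun n => (aComp N n : ℚ)) * mk_not_dvd_mul_one_sub_X_pow hN
  · have h : ∀ k ∈ Finset.Icc 1 N, constantCoeff ((X : PowerSeries ℚ) ^ k) = 0 := fun k hk => by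
      simp [Nat.one_le_iff_ne_zero.1 (Finset.mem_Icc.1 hk).1]
    rw [map_sub, map_sum, Finset.sum_eq_zero h]
    simp
end

section
/- In the free associative algebra Sym = C<S_1, S_2, ...> graded by deg S_n = n, with ribbon basis defined by R_I = sum_{J coarser than or equal to I} (-1)^{l(I)-l(J)} S^J (where S^J = S_{j_1}...S_{j_s} and J runs over coarsenings of I), the product of two ribbons satisfies R_I * R_J = R_{I.J} + R_{I▷J}, where I.J is concatenation and I▷J = (i_1,...,i_{r-1}, i_r + j_1, j_2,...,j_s). -/
open scoped Classical

noncomputable section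

/-- The algebra of noncommutative symmetric functions, realized as the free
associative algebra over `ℂ` on generators `S_1, S_2, …` (indexed by `ℕ`,
the index `0` being unused). -/
abbrev NSym : Type := FreeAlgebra ℂ ℕ

/-- The complete noncommutative symmetric function `S_n`, with `S_0 = 1`. -/
def Sg (n : ℕ) : NSym := if n = 0 then 1 else FreeAlgebra.ι ℂ n

/-- `S^I = S_{i_1} ⋯ S_{i_r}` for a composition `I` (a list of parts). -/
def SWord (I : List ℕ) : NSym := (I.map Sg).prod

/-- The list of all coarsenings of a composition (obtained by merging
adjacent blocks). -/
def coarse : List ℕ → List (List ℕ)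
  | [] => [[]]
  | [a] => [[a]]
  | a :: b :: l => ((coarse (b :: l)).map (fun K => a :: K)) ++ coarse ((a + b) :: l)
termination_by l => l.length
decreasing_by all_goals simp

/-- The noncommutative ribbon Schur function
`R_I = ∑_{J ⪯ I} (-1)^{ℓ(I) - ℓ(J)} S^J`, the sum ranging over all
coarsenings `J` of `I`. -/
def Rib (I : List ℕ) : NSym :=
  ((coarse I).map (fun J => ((-1 : ℂ) ^ (I.length - J.length)) • SWord J)).sum

/-- One elementary step of the order `≤_{P^{(N)}}`: replace one part `m + k`
by the pair `(m, k)` with `m ∈ [1, N-1]` and `k ≥ 1`. -/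
def splitStep (N : ℕ) (I J : List ℕ) : Prop :=
  ∃ (L R : List ℕ) (m k : ℕ), 1 ≤ m ∧ m ≤ N - 1 ∧ 1 ≤ k ∧
    I = L ++ (m + k) :: R ∧ J = L ++ m :: k :: R

/-- `peakLE N J I` means `J ≤_{P^{(N)}} I`, i.e. `I` can be obtained from `J`
by successively splitting parts `i` into `(m, i - m)` with `m ∈ [1, N-1]`. -/
def peakLE (N : ℕ) (J I : List ℕ) : Prop :=
  Relation.ReflTransGen (splitStep N) J I

/-- The complete peak function of order `N`:
`Σ^{(N)}_I = ∑_{J ≤_{P^{(N)}} I} R_J`. (Every `J ≤_{P^{(N)}} I` is a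
coarsening of `I`, so the sum may be taken over coarsenings of `I`.) -/
def SigmaP (N : ℕ) (I : List ℕ) : NSym :=
  ((coarse I).map (fun J => if peakLE N J I then Rib J else 0)).sum

/-- Membership in `G^{(N)}`: all parts lie in `[1, N]` and the last part lies
in `[1, N-1]`. -/
def memG (N : ℕ) (I : List ℕ) : Prop :=
  (∀ p ∈ I, 1 ≤ p ∧ p ≤ N) ∧ (∀ p, I.getLast? = some p → p ≤ N - 1)

end

theorem length_le_of_mem_coarse (I : List ℕ) : ∀ J ∈ coarse I, J.length ≤ I.length := by
  fun_induction coarse I with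
  | case1 => simp
  | case2 a => simp
  | case3 a b l ih₁ ih₂ =>
    intro J hJ
    simp only [List.mem_append, List.mem_map] at hJ
    rcases hJ with ⟨K, hK, rfl⟩ | hJ
    · simpa using ih₁ K hK
    · exact (ih₂ J hJ).trans (by simp)

theorem Rib_singleton (a : ℕ) : Rib [a] = Sg a := by
  simp [Rib, coarse, SWord]

theorem Rib_cons_cons (a b : ℕ) (l : List ℕ) :
    Rib (a :: b :: l) = Sg a * Rib (b :: l) - Rib ((a + b) :: l) := by
  rw [sub_eq_add_neg, Rib, coarse, List.map_append, List.sum_append, List.map_map]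
  congr 1
  · simp [Rib, SWord, Function.comp_def, ← List.sum_map_mul_left]
  · rw [Rib, List.sum_neg, List.map_map]
    refine congrArg List.sum (List.map_congr_left fun J hJ => ?_)
    have hlen := length_le_of_mem_coarse _ J hJ
    simp only [List.length_cons] at hlen
    rw [Function.comp_apply, ← neg_smul, List.length_cons, List.length_cons, List.length_cons,
      Nat.sub_add_comm hlen, pow_succ, mul_neg_one]

theorem Rib_append_singleton_mul_Rib_cons (l m : List ℕ) (c d : ℕ) :
    Rib (l ++ [c]) * Rib (d :: m) = Rib (l ++ c :: d :: m) + Rib (l ++ (c + d) :: m) := by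
  match l with
  | [] => simp [Rib_singleton, Rib_cons_cons c d]
  | [a] =>
    have h₁ := Rib_append_singleton_mul_Rib_cons [] m c d
    have h₂ := Rib_append_singleton_mul_Rib_cons [] m (a + c) d
    simp only [List.nil_append, List.cons_append] at h₁ h₂ ⊢
    rw [Rib_cons_cons a, Rib_cons_cons a c, Rib_cons_cons a (c + d), sub_mul, mul_assoc, h₁, h₂,
      mul_add, add_assoc a c d]
    abel
  | a :: b :: l =>
    have h₁ := Rib_append_singleton_mul_Rib_cons (b :: l) m c d
    have h₂ := Rib_append_singleton_mul_Rib_cons ((a + b) :: l) m c d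
    simp only [List.cons_append] at h₁ h₂ ⊢
    simp only [Rib_cons_cons a b, sub_mul, mul_assoc, h₁, h₂, mul_add]
    abel
termination_by l.length

/-- The ribbon multiplication rule `R_I R_J = R_{I·J} + R_{I▷J}` in the algebra
of noncommutative symmetric functions, where `I·J` is concatenation and
`I▷J = (i_1,…,i_{r-1}, i_r + j_1, j_2,…,j_s)`. -/
theorem ribbon_mul (I J : List ℕ) (hI : I ≠ []) (hJ : J ≠ [])
    (hIpos : ∀ p ∈ I, 0 < p) (hJpos : ∀ p ∈ J, 0 < p) :
    Rib I * Rib J =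
      Rib (I ++ J) + Rib (I.dropLast ++ (I.getLast hI + J.head hJ) :: J.tail) := by
  have h := Rib_append_singleton_mul_Rib_cons I.dropLast J.tail (I.getLast hI) (J.head hJ)
  rwa [List.append_cons _ (I.getLast hI) (_ :: _), List.dropLast_append_getLast hI,
    List.cons_head_tail hJ] at h
end
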